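/- There exists a universal constant C > 0 (independent of all data below) such that the following holds. Let μ be a Borel probability measure on ℝ that is absolutely continuous on I = (x₀−η, x₀+η) for some x₀ ∈ ℝ and η > 0, with density ρ on I satisfying ρ ∈ C^{0,α}(I) for some 0 ≤ α < 1, and let μ^ε denote the Poisson-smoothed measure. Then for every ε > 0, |ρ(x₀) − μ^ε(x₀)| ≤ (|ρ|_{C^{0,α}(I)} + C η^{−α} ‖ρ‖_{∞,I}) · sec(απ/2) · ε^α + ε/(π(ε² + η²/4)). -/

import Mathlib

open MeasureTheory Real Set

/-- The Poisson-smoothed measure `μ^ε(x) = (1/π) ∫ ε/(ε²+(x−y)²) dμ(y)`. -/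
noncomputable def poissonSmooth (μ : Measure ℝ) (ε x : ℝ) : ℝ :=
  (1 / π) * ∫ y, ε / (ε ^ 2 + (x - y) ^ 2) ∂μ

/-- `μ` is absolutely continuous on `I` with (nonnegative) density `ρ ∈ L¹(I)`. -/
def ACOnWithDensity (μ : Measure ℝ) (I : Set ℝ) (ρ : ℝ → ℝ) : Prop :=
  (∀ y ∈ I, 0 ≤ ρ y) ∧ IntegrableOn ρ I volume ∧
    μ.restrict I = (volume.restrict I).withDensity (fun y => ENNReal.ofReal (ρ y))

/-- `h` is `α`-Hölder continuous on `I`. -/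
def HolderOn (α : ℝ) (I : Set ℝ) (h : ℝ → ℝ) : Prop :=
  ∃ C : ℝ, 0 ≤ C ∧ ∀ x ∈ I, ∀ y ∈ I, |h x - h y| ≤ C * |x - y| ^ α

/-- The Hölder seminorm `|h|_{C^{0,α}(I)}`, realized as the least admissible
Hölder constant of `h` on `I`. -/
noncomputable def holderSemi (α : ℝ) (I : Set ℝ) (h : ℝ → ℝ) : ℝ :=
  sInf {C : ℝ | 0 ≤ C ∧ ∀ x ∈ I, ∀ y ∈ I, |h x - h y| ≤ C * |x - y| ^ α}

/-- The sup norm `‖h‖_{∞,I}`. -/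
noncomputable def supNormOn (I : Set ℝ) (h : ℝ → ℝ) : ℝ :=
  sSup ((fun x => |h x|) '' I)

theorem cos_mul_pi_div_two_pos {α : ℝ} (h0 : 0 ≤ α) (h1 : α < 1) : 0 < cos (α * π / 2) := by
  apply cos_pos_of_mem_Ioo
  constructor <;> nlinarith [pi_pos]

/-- A nonnegative function with nonzero Bochner integral has the same Lebesgue integral. -/
theorem lintegral_ofReal_eq_of_integral_ne_zero {X : Type*} [MeasurableSpace X] {ν : Measure X}
    {f : X → ℝ} {A : ℝ} (hf : 0 ≤ᵐ[ν] f) (hA : A ≠ 0) (h : ∫ x, f x ∂ν = A) :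
    ∫⁻ x, ENNReal.ofReal (f x) ∂ν = ENNReal.ofReal A := by
  rw [← ofReal_integral_eq_lintegral_ofReal (.of_integral_ne_zero (h ▸ hA)) hf, h]

theorem lintegral_rpow_mul_poisson {α ε : ℝ} (h0 : 0 ≤ α) (h1 : α < 1) (hε : 0 < ε) :
    ∫⁻ t in Ioi (0 : ℝ), ENNReal.ofReal (t ^ α * (1 / (ε ^ 2 + t ^ 2))) =
      ENNReal.ofReal (ε ^ (α - 1) * (π / 2) * (1 / cos (α * π / 2))) := by
  have hlap : ∀ t ∈ Ioi (0 : ℝ), ENNReal.ofReal (t ^ α * (1 / (ε ^ 2 + t ^ 2))) =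
      ∫⁻ u in Ioi (0 : ℝ), ENNReal.ofReal (t ^ α * exp (-u * (ε ^ 2 + t ^ 2))) := by
    intro t (ht : 0 < t)
    have hc : 0 < ε ^ 2 + t ^ 2 := by positivity
    symm
    apply lintegral_ofReal_eq_of_integral_ne_zero
    · exact Filter.Eventually.of_forall fun u => by positivity
    · positivity
    · rw [integral_const_mul]
      have h := integral_rpow_mul_exp_neg_mul_Ioi one_pos hc
      simp only [sub_self, rpow_zero, one_mul, Gamma_one, rpow_one, mul_one] at h
      rw [← h]
      congr 1
      refine setIntegral_congr_fun measurableSet_Ioi fun u _ => ?_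
      ring_nf
  have hgauss : ∀ u ∈ Ioi (0 : ℝ),
      ∫⁻ t in Ioi (0 : ℝ), ENNReal.ofReal (t ^ α * exp (-u * (ε ^ 2 + t ^ 2))) =
      ENNReal.ofReal (exp (-u * ε ^ 2) *
        (u ^ (-(α + 1) / 2) * (1 / 2) * Gamma ((α + 1) / 2))) := by
    intro u (hu : 0 < u)
    have hG : 0 < Gamma ((α + 1) / 2) := Gamma_pos_of_pos (by linarith)
    apply lintegral_ofReal_eq_of_integral_ne_zero
    · filter_upwards [ae_restrict_mem measurableSet_Ioi] with t (ht : 0 < t)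
      positivity
    · positivity
    · rw [← integral_rpow_mul_exp_neg_mul_rpow two_pos (by linarith) hu, ← integral_const_mul]
      refine setIntegral_congr_fun measurableSet_Ioi fun t _ => ?_
      simp only [rpow_two]
      rw [mul_add, exp_add]
      ring
  rw [setLIntegral_congr_fun measurableSet_Ioi hlap, lintegral_lintegral_swap,
    setLIntegral_congr_fun measurableSet_Ioi hgauss]
  · have hcos := cos_mul_pi_div_two_pos h0 h1
    have hG : 0 < Gamma ((α + 1) / 2) := Gamma_pos_of_pos (by linarith)
    apply lintegral_ofReal_eq_of_integral_ne_zero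
    · filter_upwards [ae_restrict_mem measurableSet_Ioi] with t (ht : 0 < t)
      positivity
    · positivity
    · have h := integral_rpow_mul_exp_neg_mul_Ioi (a := (1 - α) / 2) (r := ε ^ 2)
        (by linarith) (by positivity)
      have hrefl := Gamma_mul_Gamma_one_sub ((α + 1) / 2)
      rw [show π * ((α + 1) / 2) = α * π / 2 + π / 2 by ring, sin_add_pi_div_two,
        show 1 - (α + 1) / 2 = (1 - α) / 2 by ring] at hrefl
      have hpow : (1 / ε ^ 2) ^ ((1 - α) / 2) = ε ^ (α - 1) := by
        rw [one_div, inv_rpow (by positivity), ← rpow_neg (by positivity), ← rpow_natCast,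
          ← rpow_mul hε.le]
        congr 1
        push_cast
        ring
      calc _ = ∫ u in Ioi (0 : ℝ), (1 / 2 * Gamma ((α + 1) / 2)) *
              (u ^ ((1 - α) / 2 - 1) * exp (-(ε ^ 2 * u))) := by
            refine setIntegral_congr_fun measurableSet_Ioi fun u _ => ?_
            rw [show -(α + 1) / 2 = (1 - α) / 2 - 1 by ring, show -u * ε ^ 2 = -(ε ^ 2 * u) by ring]
            ring
        _ = ε ^ (α - 1) / 2 * (Gamma ((α + 1) / 2) * Gamma ((1 - α) / 2)) := by
            rw [integral_const_mul, h, hpow]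
            ring
        _ = _ := by
            rw [hrefl]
            ring
  · exact Measurable.aemeasurable (by unfold Function.uncurry; fun_prop)

/-- The absolute moment of order `α` of the Poisson kernel. -/
theorem integral_abs_rpow_mul_poisson {α ε : ℝ} (h0 : 0 ≤ α) (h1 : α < 1) (hε : 0 < ε) :
    ∫ t : ℝ, |t| ^ α * (ε / (ε ^ 2 + t ^ 2)) = π * ε ^ α * (1 / cos (α * π / 2)) := by
  have hcos := cos_mul_pi_div_two_pos h0 h1
  have hhalf : ∫ t in Ioi (0 : ℝ), t ^ α * (1 / (ε ^ 2 + t ^ 2)) =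
      ε ^ (α - 1) * (π / 2) * (1 / cos (α * π / 2)) := by
    rw [integral_eq_lintegral_of_nonneg_ae, lintegral_rpow_mul_poisson h0 h1 hε,
      ENNReal.toReal_ofReal (by positivity)]
    · filter_upwards [ae_restrict_mem measurableSet_Ioi] with t (ht : 0 < t)
      positivity
    · exact Measurable.aestronglyMeasurable (by fun_prop)
  have habs := integral_comp_abs (f := fun t : ℝ => t ^ α * (ε / (ε ^ 2 + t ^ 2)))
  simp only [sq_abs] at habs
  rw [habs]
  have : ∀ t : ℝ, t ^ α * (ε / (ε ^ 2 + t ^ 2)) = ε * (t ^ α * (1 / (ε ^ 2 + t ^ 2))) :=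
    fun t => by ring
  simp_rw [this]
  rw [integral_const_mul, hhalf, rpow_sub_one hε.ne']
  field_simp

theorem integral_abs_sub_rpow_mul_poisson {α ε : ℝ} (h0 : 0 ≤ α) (h1 : α < 1) (hε : 0 < ε)
    (x : ℝ) :
    ∫ y : ℝ, |x - y| ^ α * (ε / (ε ^ 2 + (x - y) ^ 2)) =
      π * ε ^ α * (1 / cos (α * π / 2)) := by
  rw [integral_sub_left_eq_self (fun t : ℝ => |t| ^ α * (ε / (ε ^ 2 + t ^ 2))) volume x,
    integral_abs_rpow_mul_poisson h0 h1 hε]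

theorem integrable_abs_sub_rpow_mul_poisson {α ε : ℝ} (h0 : 0 ≤ α) (h1 : α < 1) (hε : 0 < ε)
    (x : ℝ) : Integrable fun y : ℝ => |x - y| ^ α * (ε / (ε ^ 2 + (x - y) ^ 2)) := by
  have hcos := cos_mul_pi_div_two_pos h0 h1
  refine .of_integral_ne_zero ?_
  rw [integral_abs_sub_rpow_mul_poisson h0 h1 hε]
  positivity

theorem integral_poisson {ε : ℝ} (hε : 0 < ε) (x : ℝ) :
    ∫ y : ℝ, ε / (ε ^ 2 + (x - y) ^ 2) = π := by
  simpa using integral_abs_sub_rpow_mul_poisson le_rfl one_pos hε x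

theorem integrable_poisson {ε : ℝ} (hε : 0 < ε) (x : ℝ) :
    Integrable fun y : ℝ => ε / (ε ^ 2 + (x - y) ^ 2) := by
  simpa using integrable_abs_sub_rpow_mul_poisson le_rfl one_pos hε x

theorem poisson_le_inv {ε : ℝ} (hε : 0 < ε) (x y : ℝ) :
    ε / (ε ^ 2 + (x - y) ^ 2) ≤ ε⁻¹ := by
  rw [div_le_iff₀ (by positivity), inv_mul_eq_div, le_div_iff₀ hε]
  nlinarith [sq_nonneg (x - y)]

theorem integrable_poisson_of_isFiniteMeasure (μ : Measure ℝ) [IsFiniteMeasure μ] {ε : ℝ}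
    (hε : 0 < ε) (x : ℝ) : Integrable (fun y : ℝ => ε / (ε ^ 2 + (x - y) ^ 2)) μ := by
  refine Integrable.of_bound (Measurable.aestronglyMeasurable (by fun_prop)) ε⁻¹
    (Filter.Eventually.of_forall fun y => ?_)
  rw [norm_of_nonneg (by positivity)]
  exact poisson_le_inv hε x y

/-- The part of the mass away from `(x - η, x + η)` contributes little to the smoothing. -/
theorem setIntegral_compl_poisson_le (μ : Measure ℝ) [IsProbabilityMeasure μ] {ε η : ℝ}
    (hε : 0 < ε) (hη : 0 < η) (x : ℝ) :
    ∫ y in (Ioo (x - η) (x + η))ᶜ, ε / (ε ^ 2 + (x - y) ^ 2) ∂μ ≤ ε / (ε ^ 2 + η ^ 2 / 4) := by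
  have hc : 0 ≤ ε / (ε ^ 2 + η ^ 2 / 4) := by positivity
  calc _ ≤ ∫ y in (Ioo (x - η) (x + η))ᶜ, ε / (ε ^ 2 + η ^ 2 / 4) ∂μ := by
        refine setIntegral_mono_on
          (integrable_poisson_of_isFiniteMeasure μ hε x).integrableOn integrableOn_const
          measurableSet_Ioo.compl fun y hy => ?_
        have hy' : η ≤ |x - y| := by
          by_contra! h
          rw [abs_lt] at h
          exact hy ⟨by linarith, by linarith⟩
        gcongr
        have : η ^ 2 ≤ (x - y) ^ 2 := by
          rw [← sq_abs (x - y)]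
          gcongr
        nlinarith
    _ = μ.real (Ioo (x - η) (x + η))ᶜ * (ε / (ε ^ 2 + η ^ 2 / 4)) := by simp
    _ ≤ 1 * (ε / (ε ^ 2 + η ^ 2 / 4)) := by
        gcongr
        exact measureReal_le_one
    _ = _ := one_mul _

theorem ACOnWithDensity.setIntegral_eq {μ : Measure ℝ} {I : Set ℝ} {ρ : ℝ → ℝ}
    (h : ACOnWithDensity μ I ρ) (hI : MeasurableSet I) (g : ℝ → ℝ) :
    ∫ y in I, g y ∂μ = ∫ y in I, ρ y * g y := by
  obtain ⟨hnn, hint, hμ⟩ := h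
  rw [hμ, integral_withDensity_eq_integral_toReal_smul₀ hint.aemeasurable.ennreal_ofReal
    (Filter.Eventually.of_forall fun _ => ENNReal.ofReal_lt_top)]
  refine setIntegral_congr_fun hI fun y hy => ?_
  simp [ENNReal.toReal_ofReal (hnn y hy)]

theorem HolderOn.abs_sub_le {α : ℝ} {I : Set ℝ} {h : ℝ → ℝ} (hh : HolderOn α I h) {x y : ℝ}
    (hx : x ∈ I) (hy : y ∈ I) : |h x - h y| ≤ holderSemi α I h * |x - y| ^ α := by
  obtain ⟨C, hC⟩ := hh
  have hne : {C : ℝ | 0 ≤ C ∧ ∀ x ∈ I, ∀ y ∈ I, |h x - h y| ≤ C * |x - y| ^ α}.Nonempty := ⟨C, hC⟩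
  rcases (rpow_nonneg (abs_nonneg (x - y)) α).eq_or_lt with h0 | h0
  · have := hC.2 x hx y hy
    rw [← h0, mul_zero] at this ⊢
    exact this
  · rw [← div_le_iff₀ h0]
    refine le_csInf hne fun D hD => ?_
    rw [div_le_iff₀ h0]
    exact hD.2 x hx y hy

theorem holderSemi_nonneg (α : ℝ) (I : Set ℝ) (h : ℝ → ℝ) : 0 ≤ holderSemi α I h :=
  Real.sInf_nonneg fun _ hC => hC.1

theorem HolderOn.abs_le_supNormOn {α x₀ η : ℝ} {h : ℝ → ℝ} (hα : 0 ≤ α)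
    (hh : HolderOn α (Ioo (x₀ - η) (x₀ + η)) h) {x : ℝ} (hx : x ∈ Ioo (x₀ - η) (x₀ + η)) :
    |h x| ≤ supNormOn (Ioo (x₀ - η) (x₀ + η)) h := by
  obtain ⟨C, hC0, hC⟩ := hh
  refine le_csSup ⟨|h x| + C * (2 * η) ^ α, ?_⟩ ⟨x, hx, rfl⟩
  rintro _ ⟨y, hy, rfl⟩
  have hxy : |y - x| ≤ 2 * η := by
    rw [abs_le]
    constructor <;> linarith [hx.1, hx.2, hy.1, hy.2]
  have hpow : |y - x| ^ α ≤ (2 * η) ^ α := rpow_le_rpow (abs_nonneg _) hxy hα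
  have := hC y hy x hx
  have := abs_sub_abs_le_abs_sub (h y) (h x)
  have := mul_le_mul_of_nonneg_left hpow hC0
  simp only
  linarith

/-- There is a universal constant `C > 0` such that for every Borel probability
measure `μ` on `ℝ`, absolutely continuous on `I = (x₀−η, x₀+η)` with density
`ρ ∈ C^{0,α}(I)`, `0 ≤ α < 1`, and for every `ε > 0`,
`|ρ(x₀) − μ^ε(x₀)| ≤ (|ρ|_{C^{0,α}(I)} + C η^{−α}‖ρ‖_{∞,I}) sec(απ/2) ε^α
  + ε/(π(ε² + η²/4))`. -/
theorem stmt_1 :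
    ∃ C > (0 : ℝ), ∀ (μ : Measure ℝ), IsProbabilityMeasure μ →
      ∀ (x₀ η α : ℝ), 0 < η → 0 ≤ α → α < 1 → ∀ ρ : ℝ → ℝ,
      ACOnWithDensity μ (Ioo (x₀ - η) (x₀ + η)) ρ →
      HolderOn α (Ioo (x₀ - η) (x₀ + η)) ρ →
      ∀ ε : ℝ, 0 < ε →
        |ρ x₀ - poissonSmooth μ ε x₀| ≤
          (holderSemi α (Ioo (x₀ - η) (x₀ + η)) ρ
              + C * η ^ (-α) * supNormOn (Ioo (x₀ - η) (x₀ + η)) ρ)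
            * (1 / Real.cos (α * π / 2)) * ε ^ α
          + ε / (π * (ε ^ 2 + η ^ 2 / 4)) := by
  refine ⟨1, one_pos, ?_⟩
  intro μ hμ x₀ η α hη h0 h1 ρ hac hhol ε hε
  set I := Ioo (x₀ - η) (x₀ + η)
  have hIm : MeasurableSet I := measurableSet_Ioo
  have hx₀ : x₀ ∈ I := ⟨by linarith, by linarith⟩
  set S := holderSemi α I ρ
  set N := supNormOn I ρ
  set P : ℝ → ℝ := fun y => ε / (ε ^ 2 + (x₀ - y) ^ 2)
  have hPnn : ∀ y, 0 ≤ P y := fun y => by positivity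
  have hS : 0 ≤ S := holderSemi_nonneg ..
  have hN : |ρ x₀| ≤ N := hhol.abs_le_supNormOn h0 hx₀
  have hNnn : 0 ≤ N := (abs_nonneg _).trans hN
  have hPint : Integrable P := integrable_poisson hε x₀
  have hρP : Integrable (I.indicator fun y => ρ y * P y) := by
    rw [integrable_indicator_iff hIm]
    refine hac.2.1.mul_bdd (c := ε⁻¹) (Measurable.aestronglyMeasurable (by fun_prop))
      (Filter.Eventually.of_forall fun y => ?_)
    rw [norm_of_nonneg (hPnn y)]
    exact poisson_le_inv hε x₀ y
  have hlocal : |∫ y, (ρ x₀ * P y - I.indicator (fun y => ρ y * P y) y)| ≤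
      (S + η ^ (-α) * N) * (π * ε ^ α * (1 / cos (α * π / 2))) := by
    rw [← integral_abs_sub_rpow_mul_poisson h0 h1 hε x₀, ← integral_const_mul, ← norm_eq_abs]
    refine norm_integral_le_of_norm_le
      ((integrable_abs_sub_rpow_mul_poisson h0 h1 hε x₀).const_mul _)
      (Filter.Eventually.of_forall fun y => ?_)
    change |_| ≤ (S + η ^ (-α) * N) * (|x₀ - y| ^ α * P y)
    have hηα : 0 < η ^ (-α) := rpow_pos_of_pos hη _
    have hpow : 0 ≤ |x₀ - y| ^ α := by positivity
    rw [← mul_assoc]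
    by_cases hy : y ∈ I
    · rw [indicator_of_mem hy, ← sub_mul, abs_mul, abs_of_nonneg (hPnn y)]
      refine mul_le_mul_of_nonneg_right ((hhol.abs_sub_le hx₀ hy).trans ?_) (hPnn y)
      exact mul_le_mul_of_nonneg_right (le_add_of_nonneg_right (by positivity)) hpow
    · rw [indicator_of_notMem hy, sub_zero, abs_mul, abs_of_nonneg (hPnn y)]
      refine mul_le_mul_of_nonneg_right (hN.trans ?_) (hPnn y)
      have hy' : η ≤ |x₀ - y| := by
        by_contra! h
        rw [abs_lt] at h
        exact hy ⟨by linarith, by linarith⟩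
      have hone : 1 ≤ η ^ (-α) * |x₀ - y| ^ α := by
        rw [rpow_neg hη.le, inv_mul_eq_div, one_le_div (by positivity)]
        exact rpow_le_rpow hη.le hy' h0
      nlinarith [mul_nonneg hS hpow, mul_le_mul_of_nonneg_left hone hNnn]
  rw [integral_sub (hPint.const_mul _) hρP, integral_const_mul, integral_indicator hIm,
    integral_poisson hε x₀, ← hac.setIntegral_eq hIm] at hlocal
  have htail := setIntegral_compl_poisson_le μ hε hη x₀
  have htail0 : 0 ≤ ∫ y in Iᶜ, P y ∂μ := integral_nonneg hPnn
  have hsplit := integral_add_compl hIm (integrable_poisson_of_isFiniteMeasure μ hε x₀)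
  have hsmooth : ρ x₀ - poissonSmooth μ ε x₀ =
      (1 / π) * ((ρ x₀ * π - ∫ y in I, P y ∂μ) - ∫ y in Iᶜ, P y ∂μ) := by
    rw [poissonSmooth, ← hsplit]
    field_simp
    ring
  rw [hsmooth, abs_mul, abs_of_pos (by positivity : 0 < 1 / π)]
  calc _ ≤ (1 / π) * (|ρ x₀ * π - ∫ y in I, P y ∂μ| + |∫ y in Iᶜ, P y ∂μ|) := by
        gcongr
        exact abs_sub _ _
    _ ≤ (1 / π) * ((S + η ^ (-α) * N) * (π * ε ^ α * (1 / cos (α * π / 2))) +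
          ε / (ε ^ 2 + η ^ 2 / 4)) := by
        rw [abs_of_nonneg htail0]
        gcongr
    _ = _ := by
        rw [one_mul, mul_add, div_mul_eq_div_div_swap]
        field_simp
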